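/- (Theorem 3.2) Assume each ℓ_i is convex and L_i-smooth and σ_*² is finite. Run shuffled SGD for K epochs using a fixed permutation (incremental gradient) with step sizes η_k ≤ b/(n√(2L̂₀L̃₀)), and set H_K = ∑η_k, x̂_K = (∑η_k x_k)/H_K. Then H_K·(f(x̂_K) − f(x_*)) ≤ (b/(2n))‖x_0 − x_*‖₂² + ∑_{k=1}^K min{ (η_k³ n/b²)L̂₀L̃₀‖y_*‖²_{Λ^{-1}}, (η_k³(n−b)²/b²)L̃₀σ_*² }. -/

import Mathlib

open Finset Matrix

namespace SSGD

/-- squared Euclidean norm of a finite vector -/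
noncomputable def sq {ι : Type*} [Fintype ι] (x : ι → ℝ) : ℝ := ∑ i, (x i) ^ 2

/-- Euclidean dot product -/
noncomputable def dot {ι : Type*} [Fintype ι] (x y : ι → ℝ) : ℝ := ∑ i, x i * y i

/-- weighted squared norm `‖u‖²_{(diag w)⁻¹} = ∑ i, (u i)² / w i` -/
noncomputable def wsq {ι : Type*} [Fintype ι] (w u : ι → ℝ) : ℝ := ∑ i, (u i) ^ 2 / w i

/-- operator (spectral) norm of a real matrix -/
noncomputable def opNorm {α β : Type*} [Fintype α] [Fintype β] [DecidableEq β]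
    (M : Matrix α β ℝ) : ℝ :=
  ‖LinearMap.toContinuousLinearMap (Matrix.toEuclideanLin M)‖

/-- `0`-based global index of the `j`-th element of the `i`-th batch of size `b` -/
def idx (b m : ℕ) (i : Fin m) (j : Fin b) : Fin (b * m) :=
  ⟨b * i.1 + j.1, by
    have hi : i.1 + 1 ≤ m := i.2
    have hj : j.1 < b := j.2
    calc b * i.1 + j.1 < b * i.1 + b := by omega
      _ = b * (i.1 + 1) := by ring
      _ ≤ b * m := Nat.mul_le_mul (le_refl b) hi⟩

/-- `I_{j↑}` : the identity matrix with its first `j` diagonal entries zeroed out -/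
noncomputable def Iup (n j : ℕ) : Matrix (Fin n) (Fin n) ℝ :=
  Matrix.diagonal fun i => if j ≤ i.1 then 1 else 0

/-- `I_{(j)}` (`j` 0-based) : diagonal matrix with ones exactly in positions
`b*j, …, b*(j+1)-1` -/
noncomputable def Iblk (n b j : ℕ) : Matrix (Fin n) (Fin n) ℝ :=
  Matrix.diagonal fun i => if b * j ≤ i.1 ∧ i.1 < b * (j + 1) then 1 else 0

variable {d b m : ℕ}

/-- the row-permuted data matrix `A_π` (row `i` of `A_π` is row `π i` of `A`) -/
def permMat (A : Matrix (Fin (b * m)) (Fin d) ℝ) (π : Equiv.Perm (Fin (b * m))) :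
    Matrix (Fin (b * m)) (Fin d) ℝ :=
  A.submatrix π id

/-- `Ĉ_π = (1/(m·n)) ‖W_π^{1/2} (∑_{j=1}^m I_{b(j-1)↑} A_π A_πᵀ I_{b(j-1)↑}) W_π^{1/2}‖₂`;
this is `L̂_π` for `w = L` and `Ĝ_π` for `w = G²`. -/
noncomputable def hatC (A : Matrix (Fin (b * m)) (Fin d) ℝ) (w : Fin (b * m) → ℝ)
    (π : Equiv.Perm (Fin (b * m))) : ℝ :=
  (1 / ((m : ℝ) * ((b * m : ℕ) : ℝ))) * opNorm
    (Matrix.diagonal (fun i => Real.sqrt (w (π i))) *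
      (∑ j : Fin m,
        Iup (b * m) (b * j.1) * (permMat A π * (permMat A π)ᵀ) * Iup (b * m) (b * j.1)) *
      Matrix.diagonal (fun i => Real.sqrt (w (π i))))

/-- `C̃_π = (1/b) ‖W_π^{1/2} (∑_{j=1}^m I_{(j)} A_π A_πᵀ I_{(j)}) W_π^{1/2}‖₂`;
this is `L̃_π` for `w = L` and `G̃_π` for `w = G²`. -/
noncomputable def tilC (A : Matrix (Fin (b * m)) (Fin d) ℝ) (w : Fin (b * m) → ℝ)
    (π : Equiv.Perm (Fin (b * m))) : ℝ :=
  (1 / (b : ℝ)) * opNorm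
    (Matrix.diagonal (fun i => Real.sqrt (w (π i))) *
      (∑ j : Fin m,
        Iblk (b * m) b j.1 * (permMat A π * (permMat A π)ᵀ) * Iblk (b * m) b j.1) *
      Matrix.diagonal (fun i => Real.sqrt (w (π i))))

/-- one inner (mini-batch) step of shuffled SGD, using the (sub)gradient selection `g` -/
noncomputable def step (A : Matrix (Fin (b * m)) (Fin d) ℝ) (g : Fin (b * m) → ℝ → ℝ)
    (η : ℝ) (π : Equiv.Perm (Fin (b * m))) (i : Fin m) (x : Fin d → ℝ) : Fin d → ℝ :=
  fun t => x t - (η / (b : ℝ)) *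
    ∑ j : Fin b, g (π (idx b m i j)) (dot (A (π (idx b m i j))) x) * A (π (idx b m i j)) t

/-- the primal iterates `x_{k-1,1}, …, x_{k-1,m+1}` within a single epoch
(`inIter A g η π x0 i` is `x_{k-1,i+1}`, so `inIter … 0 = x_{k-1}` and
`inIter … m = x_k`) -/
noncomputable def inIter (A : Matrix (Fin (b * m)) (Fin d) ℝ) (g : Fin (b * m) → ℝ → ℝ)
    (η : ℝ) (π : Equiv.Perm (Fin (b * m))) (x0 : Fin d → ℝ) : ℕ → Fin d → ℝ
  | 0 => x0
  | i + 1 =>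
    if h : i < m then step A g η π ⟨i, h⟩ (inIter A g η π x0 i) else inIter A g η π x0 i

/-- the dual vector `y_k` of one epoch, in permuted coordinates: its `p`-th entry is
`g_{π(p)}(a_{π(p)}ᵀ x_{k-1,i})` where `i` is the batch containing position `p` -/
noncomputable def dualY (A : Matrix (Fin (b * m)) (Fin d) ℝ) (g : Fin (b * m) → ℝ → ℝ)
    (η : ℝ) (π : Equiv.Perm (Fin (b * m))) (x0 : Fin d → ℝ) : Fin (b * m) → ℝ :=
  fun p => g (π p) (dot (A (π p)) (inIter A g η π x0 (p.1 / b)))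

/-- multi-epoch shuffled SGD: `xSeq A g η πs x0 k` is the iterate after `k` full epochs;
the (0-based) epoch `k` uses the permutation `πs k` and the step size `η k`. -/
noncomputable def xSeq (A : Matrix (Fin (b * m)) (Fin d) ℝ) (g : Fin (b * m) → ℝ → ℝ)
    (η : ℕ → ℝ) (πs : ℕ → Equiv.Perm (Fin (b * m))) (x0 : Fin d → ℝ) : ℕ → Fin d → ℝ
  | 0 => x0
  | k + 1 => inIter A g (η k) (πs k) (xSeq A g η πs x0 k) m

/-- the convex (Fenchel) conjugate of `f : ℝ → ℝ` -/
noncomputable def fconj (f : ℝ → ℝ) (y : ℝ) : ℝ := sSup (Set.range fun t => y * t - f t)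

/-- the Lagrangian `𝓛(x,y) = (1/n) ⟨A x, y⟩ - (1/n) ∑ᵢ ℓᵢ*(yⁱ)` -/
noncomputable def Lagr (A : Matrix (Fin (b * m)) (Fin d) ℝ) (ℓ : Fin (b * m) → ℝ → ℝ)
    (x : Fin d → ℝ) (y : Fin (b * m) → ℝ) : ℝ :=
  (1 / ((b * m : ℕ) : ℝ)) * ∑ i, dot (A i) x * y i
    - (1 / ((b * m : ℕ) : ℝ)) * ∑ i, fconj (ℓ i) (y i)

/-- `g` is a (global) subgradient of `f` at `t` -/
def IsSubgrad (f : ℝ → ℝ) (t g : ℝ) : Prop := ∀ s, f t + g * (s - t) ≤ f s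

/-- expectation with respect to the uniform distribution on a finite type -/
noncomputable def Eunif {α : Type*} [Fintype α] (F : α → ℝ) : ℝ :=
  (∑ a : α, F a) / (Fintype.card α : ℝ)

/-- extend a `K`-tuple of permutations to an `ℕ`-indexed sequence (by the identity) -/
def extSeq {K n : ℕ} (g : Fin K → Equiv.Perm (Fin n)) : ℕ → Equiv.Perm (Fin n) :=
  fun k => if h : k < K then g ⟨k, h⟩ else 1

/-! ### Scalar inequalities for smooth convex functions -/

lemma tangent_le_of_monotone {φ φ' : ℝ → ℝ} (hφ : ∀ t, HasDerivAt φ (φ' t) t)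
    (hmono : Monotone φ') (s t : ℝ) : φ s + φ' s * (t - s) ≤ φ t := by
  have hc : Continuous φ := continuous_iff_continuousAt.2 fun t => (hφ t).continuousAt
  rcases lt_trichotomy s t with h | h | h
  · obtain ⟨c, hc, he⟩ := exists_hasDerivAt_eq_slope φ φ' h hc.continuousOn fun x _ => hφ x
    have hsc := hmono hc.1.le
    rw [eq_div_iff (by linarith)] at he
    nlinarith
  · subst h; simp
  · obtain ⟨c, hc, he⟩ := exists_hasDerivAt_eq_slope φ φ' h hc.continuousOn fun x _ => hφ x
    have hsc := hmono hc.2.le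
    rw [eq_div_iff (by linarith)] at he
    nlinarith

section Smooth

variable {φ φ' : ℝ → ℝ} {L : ℝ}

lemma monotone_of_convexOn (hφ : ∀ t, HasDerivAt φ (φ' t) t)
    (hconv : ConvexOn ℝ Set.univ φ) : Monotone φ' := by
  have h := hconv.monotoneOn_deriv fun t _ => (hφ t).differentiableAt
  rw [funext fun t => (hφ t).deriv] at h
  exact fun s t hst => h trivial trivial hst

lemma descent_le (hφ : ∀ t, HasDerivAt φ (φ' t) t)
    (hsmooth : ∀ s t, |φ' s - φ' t| ≤ L * |s - t|) (s t : ℝ) :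
    φ t ≤ φ s + φ' s * (t - s) + L / 2 * (t - s) ^ 2 := by
  have hd : ∀ t, HasDerivAt (fun t => L / 2 * t ^ 2 - φ t) (L * t - φ' t) t := fun t => by
    refine (((hasDerivAt_pow 2 t).const_mul (L / 2)).sub (hφ t)).congr_deriv ?_
    simp only [Nat.cast_ofNat, Nat.add_one_sub_one, pow_one]
    ring
  have hmono : Monotone fun t => L * t - φ' t := fun u v huv => by
    have h := (le_abs_self _).trans (hsmooth v u)
    rw [abs_of_nonneg (sub_nonneg.2 huv)] at h
    change L * u - φ' u ≤ L * v - φ' v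
    linarith
  have h := tangent_le_of_monotone hd hmono s t
  nlinarith

lemma tangent_add_sq_le (hφ : ∀ t, HasDerivAt φ (φ' t) t) (hconv : ConvexOn ℝ Set.univ φ)
    (hL : 0 < L) (hsmooth : ∀ s t, |φ' s - φ' t| ≤ L * |s - t|) (s t : ℝ) :
    φ s + φ' s * (t - s) + (φ' t - φ' s) ^ 2 / (2 * L) ≤ φ t := by
  set r := t - (φ' t - φ' s) / L with hr
  have h1 := tangent_le_of_monotone hφ (monotone_of_convexOn hφ hconv) s r
  have h2 := descent_le hφ hsmooth t r
  have e : φ' t * (r - t) + L / 2 * (r - t) ^ 2 - φ' s * (r - s)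
      = -(φ' t - φ' s) ^ 2 / (2 * L) - φ' s * (t - s) := by
    rw [hr]; field_simp; ring
  have e2 : -(φ' t - φ' s) ^ 2 / (2 * L) = -((φ' t - φ' s) ^ 2 / (2 * L)) := by ring
  linarith

lemma three_point_le (hφ : ∀ t, HasDerivAt φ (φ' t) t) (hconv : ConvexOn ℝ Set.univ φ)
    (hL : 0 < L) (hsmooth : ∀ s t, |φ' s - φ' t| ≤ L * |s - t|) (u v w : ℝ) :
    φ u - φ v ≤ φ' w * (u - v) + L / 2 * (u - w) ^ 2 - (φ' w - φ' v) ^ 2 / L / 2 := by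
  have h1 := tangent_add_sq_le hφ hconv hL hsmooth w v
  have h2 := descent_le hφ hsmooth w u
  have e : (φ' w - φ' v) ^ 2 / L / 2 = (φ' v - φ' w) ^ 2 / (2 * L) := by field_simp; ring
  linarith

end Smooth

/-! ### Quadratic forms and the spectral norm -/

section Quadratic

variable {ι κ : Type*} [Fintype ι] [Fintype κ]

lemma vec_sq_nonneg (x : ι → ℝ) : 0 ≤ sq x := Finset.sum_nonneg fun _ _ => sq_nonneg _

lemma sq_eq_dotProduct (x : ι → ℝ) : sq x = x ⬝ᵥ x := by
  simp only [sq, dotProduct, pow_two]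

lemma dot_sub_right (a x y : ι → ℝ) : dot a (fun t => x t - y t) = dot a x - dot a y := by
  simp only [dot, mul_sub, Finset.sum_sub_distrib]

lemma dot_sq_le (x y : ι → ℝ) : dot x y ^ 2 ≤ sq x * sq y :=
  Finset.sum_mul_sq_le_sq_mul_sq _ _ _

lemma sq_add_le (x y : ι → ℝ) : sq (fun t => x t + y t) ≤ 2 * sq x + 2 * sq y := by
  simp only [sq, Finset.mul_sum, ← Finset.sum_add_distrib]
  exact Finset.sum_le_sum fun i _ => by nlinarith [sq_nonneg (x i - y i)]

lemma sq_const_mul (c : ℝ) (x : ι → ℝ) : sq (fun t => c * x t) = c ^ 2 * sq x := by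
  simp only [sq, Finset.mul_sum, mul_pow]

lemma opNorm_nonneg [DecidableEq κ] (M : Matrix ι κ ℝ) : 0 ≤ opNorm M := norm_nonneg _

lemma dotProduct_mulVec_le_opNorm [DecidableEq ι] (M : Matrix ι ι ℝ) (v : ι → ℝ) :
    v ⬝ᵥ (M *ᵥ v) ≤ opNorm M * sq v := by
  set x : EuclideanSpace ℝ ι := WithLp.toLp 2 v with hx
  set T := LinearMap.toContinuousLinearMap (Matrix.toEuclideanLin M) with hT
  have h1 : v ⬝ᵥ (M *ᵥ v) = inner ℝ (T x) x := by
    simp [hx, hT, EuclideanSpace.inner_eq_star_dotProduct, Matrix.toLpLin_apply]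
  have h2 : sq v = ‖x‖ ^ 2 := by rw [EuclideanSpace.real_norm_sq_eq]; rfl
  rw [h1, h2]
  calc inner ℝ (T x) x ≤ ‖T x‖ * ‖x‖ := real_inner_le_norm _ _
    _ ≤ ‖T‖ * ‖x‖ * ‖x‖ := by gcongr; exact T.le_opNorm x
    _ = opNorm M * ‖x‖ ^ 2 := by rw [opNorm, ← hT]; ring

lemma dotProduct_diagonal_gram [DecidableEq ι] {J : Type*} [Fintype J] (A : Matrix ι κ ℝ)
    (s : ι → ℝ) (c : J → ι → ℝ) (v : ι → ℝ) :
    v ⬝ᵥ ((Matrix.diagonal s *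
        (∑ j, Matrix.diagonal (c j) * (A * Aᵀ) * Matrix.diagonal (c j)) *
        Matrix.diagonal s) *ᵥ v)
      = ∑ j, sq (fun t => ∑ l, c j l * (s l * v l) * A l t) := by
  rw [Finset.mul_sum, Finset.sum_mul, Matrix.sum_mulVec, dotProduct_sum]
  refine Finset.sum_congr rfl fun j _ => ?_
  have hdiag : ∀ f g : ι → ℝ, Matrix.diagonal f *ᵥ g = fun l => f l * g l := fun f g =>
    funext fun l => Matrix.mulVec_diagonal f g l
  have hflip : ∀ f g h : ι → ℝ, g ⬝ᵥ (Matrix.diagonal f *ᵥ h) = (fun l => f l * g l) ⬝ᵥ h :=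
    fun f g h => by
      simp only [hdiag, dotProduct]
      exact Finset.sum_congr rfl fun _ _ => by ring
  simp only [← Matrix.mulVec_mulVec, hflip]
  simp only [hdiag]
  rw [Matrix.dotProduct_mulVec, ← Matrix.mulVec_transpose, sq_eq_dotProduct]
  have : (Aᵀ *ᵥ fun l => c j l * (s l * v l)) = fun t => ∑ l, c j l * (s l * v l) * A l t := by
    funext t
    simp only [Matrix.mulVec, dotProduct, Matrix.transpose_apply]
    exact Finset.sum_congr rfl fun _ _ => by ring
  rw [this]

end Quadratic

/-! ### Bounds through the constants `L̂` and `L̃` -/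

/-- the vector `Aᵀ I_{b i ↑} y` -/
noncomputable def tailComb (A : Matrix (Fin (b * m)) (Fin d) ℝ) (y : Fin (b * m) → ℝ) (i : ℕ) :
    Fin d → ℝ :=
  fun t => ∑ l, (if b * i ≤ l.1 then 1 else 0) * y l * A l t

lemma hatC_nonneg (A : Matrix (Fin (b * m)) (Fin d) ℝ) (w : Fin (b * m) → ℝ)
    (π : Equiv.Perm (Fin (b * m))) : 0 ≤ hatC A w π :=
  mul_nonneg (by positivity) (opNorm_nonneg _)

lemma tilC_nonneg (A : Matrix (Fin (b * m)) (Fin d) ℝ) (w : Fin (b * m) → ℝ)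
    (π : Equiv.Perm (Fin (b * m))) : 0 ≤ tilC A w π :=
  mul_nonneg (by positivity) (opNorm_nonneg _)

lemma sum_sq_tailComb_le (hb : 0 < b) (hm : 0 < m) (A : Matrix (Fin (b * m)) (Fin d) ℝ)
    {L : Fin (b * m) → ℝ} (hL : ∀ i, 0 < L i) (y : Fin (b * m) → ℝ) :
    ∑ i : Fin m, sq (tailComb A y i.1) ≤ m * ((b * m : ℕ) : ℝ) * hatC A L 1 * wsq L y := by
  have h := dotProduct_mulVec_le_opNorm (Matrix.diagonal (fun i => Real.sqrt (L i)) *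
      (∑ j : Fin m, Iup (b * m) (b * j.1) * (A * Aᵀ) * Iup (b * m) (b * j.1)) *
      Matrix.diagonal (fun i => Real.sqrt (L i))) (fun l => y l / Real.sqrt (L l))
  have hC : m * ((b * m : ℕ) : ℝ) * hatC A L 1 =
      opNorm (Matrix.diagonal (fun i => Real.sqrt (L i)) *
      (∑ j : Fin m, Iup (b * m) (b * j.1) * (A * Aᵀ) * Iup (b * m) (b * j.1)) *
      Matrix.diagonal (fun i => Real.sqrt (L i))) := by
    have hb' : (b : ℝ) ≠ 0 := by positivity
    have hm' : (m : ℝ) ≠ 0 := by positivity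
    have : permMat A 1 = A := rfl
    simp only [hatC, this, Equiv.Perm.coe_one, id_eq]
    push_cast
    field_simp
  have hw : sq (fun l => y l / Real.sqrt (L l)) = wsq L y :=
    Finset.sum_congr rfl fun l _ => by rw [div_pow, Real.sq_sqrt (hL l).le]
  rw [hC, ← hw]
  refine le_trans (le_of_eq ?_) h
  simp only [Iup, dotProduct_diagonal_gram]
  refine Finset.sum_congr rfl fun j _ => ?_
  congr 1
  funext t
  refine Finset.sum_congr rfl fun l _ => ?_
  rw [mul_div_cancel₀ _ (Real.sqrt_pos.2 (hL l)).ne']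

lemma sum_block_le (hb : 0 < b) (A : Matrix (Fin (b * m)) (Fin d) ℝ)
    {L : Fin (b * m) → ℝ} (hL : ∀ i, 0 < L i) (i : Fin m) (w : Fin d → ℝ) :
    ∑ l : Fin (b * m), (if b * i.1 ≤ l.1 ∧ l.1 < b * (i.1 + 1) then L l * dot (A l) w ^ 2 else 0)
      ≤ b * tilC A L 1 * sq w := by
  set c : Fin m → Fin (b * m) → ℝ := fun j l =>
    if b * j.1 ≤ l.1 ∧ l.1 < b * (j.1 + 1) then 1 else 0 with hc
  set v : Fin (b * m) → ℝ := fun l => c i l * (Real.sqrt (L l) * dot (A l) w) with hv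
  set S := ∑ l : Fin (b * m),
    (if b * i.1 ≤ l.1 ∧ l.1 < b * (i.1 + 1) then L l * dot (A l) w ^ 2 else 0) with hS
  have h := dotProduct_mulVec_le_opNorm (Matrix.diagonal (fun i => Real.sqrt (L i)) *
      (∑ j : Fin m, Iblk (b * m) b j.1 * (A * Aᵀ) * Iblk (b * m) b j.1) *
      Matrix.diagonal (fun i => Real.sqrt (L i))) v
  have hC : b * tilC A L 1 = opNorm (Matrix.diagonal (fun i => Real.sqrt (L i)) *
      (∑ j : Fin m, Iblk (b * m) b j.1 * (A * Aᵀ) * Iblk (b * m) b j.1) *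
      Matrix.diagonal (fun i => Real.sqrt (L i))) := by
    have hb' : (b : ℝ) ≠ 0 := by positivity
    have : permMat A 1 = A := rfl
    simp only [tilC, this, Equiv.Perm.coe_one, id_eq]
    field_simp
  rw [← hC] at h
  have hvS : sq v = S := by
    refine Finset.sum_congr rfl fun l _ => ?_
    simp only [hv, hc]
    split_ifs
    · rw [one_mul, mul_pow, Real.sq_sqrt (hL l).le]
    · ring
  set q : Fin m → Fin d → ℝ := fun j t => ∑ l, c j l * (Real.sqrt (L l) * v l) * A l t with hq
  have hle : sq (q i) ≤ b * tilC A L 1 * S := by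
    rw [← hvS]
    refine le_trans ?_ h
    simp only [Iblk, dotProduct_diagonal_gram]
    exact Finset.single_le_sum (f := fun j => sq (q j)) (fun j _ => vec_sq_nonneg _)
      (Finset.mem_univ i)
  have hdot : dot (q i) w = S := by
    simp only [dot, hq, Finset.sum_mul]
    rw [Finset.sum_comm]
    refine Finset.sum_congr rfl fun l _ => ?_
    simp only [mul_assoc, ← Finset.mul_sum]
    change c i l * (_ * (c i l * (_ * dot (A l) w) * dot (A l) w)) = _
    simp only [hc]
    split_ifs
    · have := Real.mul_self_sqrt (hL l).le
      calc _ = (Real.sqrt (L l) * Real.sqrt (L l)) * dot (A l) w ^ 2 := by ring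
        _ = _ := by rw [this]
    · ring
  have hCS := dot_sq_le (q i) w
  rw [hdot] at hCS
  have hS0 : 0 ≤ S := hvS ▸ vec_sq_nonneg v
  have hB : 0 ≤ b * tilC A L 1 * sq w :=
    mul_nonneg (mul_nonneg b.cast_nonneg (tilC_nonneg _ _ _)) (vec_sq_nonneg w)
  rcases hS0.eq_or_lt with h0 | h0
  · rwa [← h0]
  · refine le_of_mul_le_mul_right ?_ h0
    nlinarith [mul_le_mul_of_nonneg_right hle (vec_sq_nonneg w)]

/-! ### The inner iterates -/

lemma sum_idx_eq (i : Fin m) (F : Fin (b * m) → ℝ) :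
    ∑ j : Fin b, F (idx b m i j)
      = ∑ l : Fin (b * m), if b * i.1 ≤ l.1 ∧ l.1 < b * (i.1 + 1) then F l else 0 := by
  rw [← Finset.sum_filter]
  refine Finset.sum_bij (fun j _ => idx b m i j) ?_ ?_ ?_ ?_
  · intro j _
    simp only [Finset.mem_filter, Finset.mem_univ, true_and, idx, mul_add, mul_one]
    omega
  · intro j _ k _ h
    simp only [idx, Fin.mk.injEq] at h
    exact Fin.ext (by omega)
  · intro l hl
    simp only [Finset.mem_filter, Finset.mem_univ, true_and, mul_add, mul_one] at hl
    exact ⟨⟨l.1 - b * i.1, by omega⟩, Finset.mem_univ _, Fin.ext (by simp only [idx]; omega)⟩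
  · intro _ _; rfl

lemma inIter_eq (A : Matrix (Fin (b * m)) (Fin d) ℝ) (g : Fin (b * m) → ℝ → ℝ)
    (η : ℝ) (x : Fin d → ℝ) (i : ℕ) (hi : i ≤ m) (t : Fin d) :
    inIter A g η 1 x i t = x t - η / b *
      ∑ l : Fin (b * m), (if l.1 < b * i then dualY A g η 1 x l * A l t else 0) := by
  induction i with
  | zero => simp [inIter]
  | succ i ih =>
    have him : i < m := hi
    rw [inIter, dif_pos him]
    simp only [step, Equiv.Perm.coe_one, id_eq]
    rw [sum_idx_eq ⟨i, him⟩ fun l => g l (dot (A l) (inIter A g η 1 x i)) * A l t, ih him.le,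
      sub_sub, ← mul_add, ← Finset.sum_add_distrib]
    congr 2
    refine Finset.sum_congr rfl fun l _ => ?_
    simp only [mul_add, mul_one, dualY, Equiv.Perm.coe_one, id_eq]
    by_cases h1 : l.1 < b * i
    · rw [if_pos h1, if_neg (by omega), if_pos (by omega), add_zero]
    · rw [if_neg h1, zero_add]
      by_cases h2 : l.1 < b * i + b
      · have hdiv : l.1 / b = i := by
          rw [Nat.div_eq_of_lt_le]
          · linarith [mul_comm i b]
          · linarith [Nat.succ_mul i b, mul_comm i b]
        rw [if_pos (by omega), if_pos h2, hdiv]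
      · rw [if_neg (by omega), if_neg h2]

lemma inIter_last_sub (A : Matrix (Fin (b * m)) (Fin d) ℝ) (g : Fin (b * m) → ℝ → ℝ)
    (η : ℝ) (x : Fin d → ℝ) (i : ℕ) (hi : i ≤ m) (t : Fin d) :
    inIter A g η 1 x m t - inIter A g η 1 x i t
      = -(η / b) * tailComb A (dualY A g η 1 x) i t := by
  rw [inIter_eq A g η x m le_rfl, inIter_eq A g η x i hi, tailComb, sub_sub_sub_cancel_left,
    ← mul_sub, ← Finset.sum_sub_distrib, neg_mul, ← mul_neg, ← Finset.sum_neg_distrib]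
  congr 1
  refine Finset.sum_congr rfl fun l _ => ?_
  rw [if_pos l.2]
  by_cases h : l.1 < b * i
  · rw [if_pos h, if_neg (by omega)]; ring
  · rw [if_neg h, if_pos (by omega)]; ring

lemma sum_drift_le (hb : 0 < b) (A : Matrix (Fin (b * m)) (Fin d) ℝ)
    (g : Fin (b * m) → ℝ → ℝ) {L : Fin (b * m) → ℝ} (hL : ∀ i, 0 < L i) (η : ℝ)
    (x : Fin d → ℝ) :
    ∑ l : Fin (b * m), L l *
        (dot (A l) (inIter A g η 1 x m) - dot (A l) (inIter A g η 1 x (l.1 / b))) ^ 2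
      ≤ η ^ 2 / b * tilC A L 1 * ∑ i : Fin m, sq (tailComb A (dualY A g η 1 x) i.1) := by
  set w : ℕ → Fin d → ℝ := fun i t => inIter A g η 1 x m t - inIter A g η 1 x i t with hw
  have hb' : (b : ℝ) ≠ 0 := by positivity
  have hsplit : ∀ l : Fin (b * m),
      L l * (dot (A l) (inIter A g η 1 x m) - dot (A l) (inIter A g η 1 x (l.1 / b))) ^ 2
      = ∑ i : Fin m, if b * i.1 ≤ l.1 ∧ l.1 < b * (i.1 + 1) then
          L l * dot (A l) (w i.1) ^ 2 else 0 := fun l => by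
    have hlt : l.1 / b < m := Nat.div_lt_of_lt_mul l.2
    have hmem : ∀ i : Fin m, (b * i.1 ≤ l.1 ∧ l.1 < b * (i.1 + 1)) ↔ i = ⟨l.1 / b, hlt⟩ := by
      intro i
      rw [Fin.ext_iff, eq_comm, Nat.div_eq_iff hb, mul_add, mul_comm b]
      omega
    simp only [hmem, Finset.sum_ite_eq', Finset.mem_univ, if_true, hw, dot_sub_right]
  rw [Finset.sum_congr rfl fun l _ => hsplit l, Finset.sum_comm, Finset.mul_sum]
  refine Finset.sum_le_sum fun i _ => (sum_block_le hb A hL i (w i.1)).trans (le_of_eq ?_)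
  have : w i.1 = fun t => -(η / b) * tailComb A (dualY A g η 1 x) i.1 t :=
    funext fun t => inIter_last_sub A g η x i.1 i.2.le t
  rw [this, sq_const_mul]
  field_simp

/-! ### One epoch -/

lemma epoch_descent (hb : 0 < b) (hm : 0 < m) (A : Matrix (Fin (b * m)) (Fin d) ℝ)
    {ℓ ℓ' : Fin (b * m) → ℝ → ℝ} {L : Fin (b * m) → ℝ} (hL : ∀ i, 0 < L i)
    (hconv : ∀ i, ConvexOn ℝ Set.univ (ℓ i)) (hderiv : ∀ i t, HasDerivAt (ℓ i) (ℓ' i t) t)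
    (hsmooth : ∀ i s t, |ℓ' i s - ℓ' i t| ≤ L i * |s - t|) (xstar : Fin d → ℝ) {η : ℝ}
    (hη : 0 < η)
    (hstep : η ≤ (b : ℝ) / (((b * m : ℕ) : ℝ) * Real.sqrt (2 * hatC A L 1 * tilC A L 1)))
    (x : Fin d → ℝ) :
    η * (∑ i, ℓ i (dot (A i) (inIter A ℓ' η 1 x m)) - ∑ i, ℓ i (dot (A i) xstar))
      ≤ b / 2 * (sq (fun t => x t - xstar t) - sq (fun t => inIter A ℓ' η 1 x m t - xstar t))
        + η ^ 3 / b * tilC A L 1 *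
          ∑ i : Fin m, sq (tailComb A (fun l => ℓ' l (dot (A l) xstar)) i.1) := by
  set z := inIter A ℓ' η 1 x m with hz
  set y := dualY A ℓ' η 1 x with hy
  set ystar : Fin (b * m) → ℝ := fun l => ℓ' l (dot (A l) xstar) with hys
  have hb' : (0 : ℝ) < b := by positivity
  have hm' : (0 : ℝ) < m := by positivity
  have hT := tilC_nonneg A L 1
  have hH := hatC_nonneg A L 1
  have hlin : η * ∑ l, y l * (dot (A l) z - dot (A l) xstar)
      ≤ b / 2 * (sq (fun t => x t - xstar t) - sq (fun t => z t - xstar t)) := by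
    have h0 : ∀ t, η * ∑ l, y l * A l t = b * (x t - z t) := fun t => by
      have h := inIter_eq A ℓ' η x m le_rfl t
      simp only [Fin.is_lt, if_true] at h
      rw [← hz, ← hy] at h
      rw [h]
      field_simp
      ring
    have h1 : η * ∑ l, y l * (dot (A l) z - dot (A l) xstar)
        = ∑ t, b * (x t - z t) * (z t - xstar t) := by
      simp only [← h0, Finset.mul_sum, Finset.sum_mul]
      rw [Finset.sum_comm]
      simp only [dot, ← Finset.sum_sub_distrib, Finset.mul_sum]
      exact Finset.sum_congr rfl fun _ _ => Finset.sum_congr rfl fun _ _ => by ring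
    rw [h1, sq, sq, ← Finset.sum_sub_distrib, Finset.mul_sum]
    exact Finset.sum_le_sum fun t _ => by
      nlinarith [mul_nonneg hb'.le (sq_nonneg (x t - z t))]
  have hpt : ∑ i, ℓ i (dot (A i) z) - ∑ i, ℓ i (dot (A i) xstar)
      ≤ ∑ l, y l * (dot (A l) z - dot (A l) xstar)
        + (∑ l : Fin (b * m), L l *
          (dot (A l) z - dot (A l) (inIter A ℓ' η 1 x (l.1 / b))) ^ 2) / 2
        - wsq L (fun l => y l - ystar l) / 2 := by
    rw [wsq, Finset.sum_div, Finset.sum_div, ← Finset.sum_sub_distrib, ← Finset.sum_add_distrib,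
      ← Finset.sum_sub_distrib]
    refine Finset.sum_le_sum fun l _ => ?_
    have h := three_point_le (hderiv l) (hconv l) (hL l) (hsmooth l) (dot (A l) z)
      (dot (A l) xstar) (dot (A l) (inIter A ℓ' η 1 x (l.1 / b)))
    refine h.trans (le_of_eq ?_)
    simp only [hy, hys, dualY, Equiv.Perm.coe_one, id_eq]
    ring
  have hdrift := sum_drift_le hb A ℓ' hL η x
  rw [← hz, ← hy] at hdrift
  have hcomb : ∑ i : Fin m, sq (tailComb A y i.1)
      ≤ 2 * ∑ i : Fin m, sq (tailComb A (fun l => y l - ystar l) i.1)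
        + 2 * ∑ i : Fin m, sq (tailComb A ystar i.1) := by
    rw [Finset.mul_sum, Finset.mul_sum, ← Finset.sum_add_distrib]
    refine Finset.sum_le_sum fun i _ => le_trans (le_of_eq ?_) (sq_add_le _ _)
    congr 1
    funext t
    simp only [tailComb, ← Finset.sum_add_distrib]
    exact Finset.sum_congr rfl fun _ _ => by ring
  have hhat := sum_sq_tailComb_le hb hm A hL fun l => y l - ystar l
  have hW : 0 ≤ wsq L (fun l => y l - ystar l) :=
    Finset.sum_nonneg fun l _ => div_nonneg (sq_nonneg _) (hL l).le
  have hstep' : 2 * (η ^ 2 * m ^ 2 * (hatC A L 1 * tilC A L 1)) ≤ 1 := by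
    set S := 2 * hatC A L 1 * tilC A L 1 with hS
    have hS0 : 0 ≤ S := by positivity
    have hsqrt : 0 < Real.sqrt S := by
      refine (Real.sqrt_nonneg S).lt_of_ne fun h => ?_
      rw [← h, mul_zero, div_zero] at hstep
      linarith
    rw [le_div_iff₀ (by push_cast; positivity)] at hstep
    push_cast at hstep
    have h1 : η * m * Real.sqrt S ≤ 1 := by
      refine le_of_mul_le_mul_left ?_ hb'
      linarith
    have h2 : (η * m * Real.sqrt S) ^ 2 ≤ 1 := pow_le_one₀ (by positivity) h1
    rw [mul_pow, Real.sq_sqrt hS0, hS] at h2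
    linarith
  set Y := ∑ i : Fin m, sq (tailComb A ystar i.1)
  set Z := ∑ i : Fin m, sq (tailComb A (fun l => y l - ystar l) i.1)
  set W := wsq L (fun l => y l - ystar l)
  have hZ : η ^ 2 / b * tilC A L 1 * Z ≤ W / 2 := by
    calc η ^ 2 / b * tilC A L 1 * Z
        ≤ η ^ 2 / b * tilC A L 1 * (m * ((b * m : ℕ) : ℝ) * hatC A L 1 * W) := by gcongr
      _ = (2 * (η ^ 2 * m ^ 2 * (hatC A L 1 * tilC A L 1))) * W / 2 := by
        push_cast; field_simp
      _ ≤ 1 * W / 2 := by gcongr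
      _ = W / 2 := by ring
  have hD : η ^ 2 / b * tilC A L 1 * ∑ i : Fin m, sq (tailComb A y i.1)
      ≤ η ^ 2 / b * tilC A L 1 * (2 * Z + 2 * Y) := by gcongr
  have hfin : ∑ i, ℓ i (dot (A i) z) - ∑ i, ℓ i (dot (A i) xstar)
      ≤ ∑ l, y l * (dot (A l) z - dot (A l) xstar) + η ^ 2 / b * tilC A L 1 * Y := by
    linarith
  calc _ ≤ η * (∑ l, y l * (dot (A l) z - dot (A l) xstar) + η ^ 2 / b * tilC A L 1 * Y) := by
        gcongr
    _ = η * ∑ l, y l * (dot (A l) z - dot (A l) xstar) + η ^ 3 / b * tilC A L 1 * Y := by ring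
    _ ≤ _ := by gcongr

/-! ### The residual at the minimizer -/

lemma sum_grad_eq_zero {N : ℕ} (A : Matrix (Fin N) (Fin d) ℝ) {ℓ ℓ' : Fin N → ℝ → ℝ}
    (hderiv : ∀ i t, HasDerivAt (ℓ i) (ℓ' i t) t) (xstar : Fin d → ℝ)
    (hmin : ∀ x : Fin d → ℝ, ∑ i, ℓ i (dot (A i) xstar) ≤ ∑ i, ℓ i (dot (A i) x)) (t : Fin d) :
    ∑ i, ℓ' i (dot (A i) xstar) * A i t = 0 := by
  have hd : HasDerivAt (fun s : ℝ => ∑ i, ℓ i (dot (A i) xstar + s * A i t))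
      (∑ i, ℓ' i (dot (A i) xstar) * A i t) 0 := by
    refine HasDerivAt.fun_sum fun i _ => ?_
    have h1 : HasDerivAt (fun s : ℝ => dot (A i) xstar + s * A i t) (A i t) 0 := by
      simpa using ((hasDerivAt_id (0 : ℝ)).mul_const (A i t)).const_add (dot (A i) xstar)
    exact HasDerivAt.comp (0 : ℝ) (by simpa using hderiv i (dot (A i) xstar)) h1
  refine IsLocalMin.hasDerivAt_eq_zero (Filter.Eventually.of_forall fun s => ?_) hd
  have h := hmin fun t' => xstar t' + s * if t' = t then 1 else 0
  have e : ∀ i, dot (A i) (fun t' => xstar t' + s * if t' = t then 1 else 0)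
      = dot (A i) xstar + s * A i t := fun i => by
    simp [dot, mul_add, Finset.sum_add_distrib, mul_comm]
  simpa only [e, zero_mul, add_zero] using h

lemma sq_sum_smul_le {ι : Type*} (s : Finset ι) (u : ι → Fin d → ℝ) :
    sq (fun t => ∑ l ∈ s, u l t) ≤ s.card * ∑ l ∈ s, sq (u l) := by
  simp only [sq]
  rw [Finset.sum_comm, Finset.mul_sum]
  exact Finset.sum_le_sum fun t _ => sq_sum_le_card_mul_sum_sq

lemma sum_sq_tailComb_le_of_sum_eq_zero (hb : 0 < b) (A : Matrix (Fin (b * m)) (Fin d) ℝ)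
    (y : Fin (b * m) → ℝ) (hy : ∀ t, ∑ l, y l * A l t = 0) (hm : 0 < m) :
    ∑ i : Fin m, sq (tailComb A y i.1)
      ≤ (((b * m : ℕ) : ℝ) - b) ^ 2 / b * ∑ l, y l ^ 2 * sq (A l) := by
  obtain ⟨m, rfl⟩ : ∃ k, m = k + 1 := ⟨m - 1, by omega⟩
  have hb' : (b : ℝ) ≠ 0 := by positivity
  set S := ∑ l, y l ^ 2 * sq (A l)
  have hzero : sq (tailComb A y 0) = 0 := by
    have : tailComb A y 0 = fun _ => 0 := funext fun t => by simpa [tailComb] using hy t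
    rw [this]; simp [sq]
  have hterm : ∀ i : Fin m, sq (tailComb A y (i.1 + 1)) ≤ (b * m) * S := fun i => by
    set s := Finset.univ.filter fun l : Fin (b * (m + 1)) => b * (i.1 + 1) ≤ l.1 with hs
    have e : tailComb A y (i.1 + 1) = fun t => ∑ l ∈ s, y l * A l t := funext fun t => by
      rw [tailComb, hs, Finset.sum_filter]
      exact Finset.sum_congr rfl fun l _ => by split_ifs <;> ring
    have hcard : s.card ≤ b * m := by
      have hmaps : ∀ l ∈ s, l.1 ∈ Finset.Ico b (b * (m + 1)) := fun l hl => by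
        have h1 := (Finset.mem_filter.1 hl).2
        have h2 := l.2
        rw [mul_add, mul_one] at h1
        exact Finset.mem_Ico.2 ⟨by omega, h2⟩
      have h := Finset.card_le_card_of_injOn Fin.val hmaps Fin.val_injective.injOn
      rw [Nat.card_Ico] at h
      exact h.trans (by rw [mul_add, mul_one]; omega)
    rw [e]
    refine (sq_sum_smul_le s fun l t => y l * A l t).trans ?_
    simp only [sq_const_mul]
    have hsum : ∑ l ∈ s, y l ^ 2 * sq (A l) ≤ S :=
      Finset.sum_le_univ_sum_of_nonneg fun l => mul_nonneg (sq_nonneg _) (vec_sq_nonneg _)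
    have h0 : 0 ≤ ∑ l ∈ s, y l ^ 2 * sq (A l) :=
      Finset.sum_nonneg fun l _ => mul_nonneg (sq_nonneg _) (vec_sq_nonneg _)
    exact mul_le_mul (by exact_mod_cast hcard) hsum h0 (by positivity)
  rw [Fin.sum_univ_succ]
  simp only [Fin.val_zero, hzero, zero_add, Fin.val_succ]
  calc ∑ i : Fin m, sq (tailComb A y (i.1 + 1)) ≤ ∑ _i : Fin m, (b * m) * S :=
        Finset.sum_le_sum fun i _ => hterm i
    _ = _ := by
      simp only [Finset.sum_const, Finset.card_univ, Fintype.card_fin, nsmul_eq_mul]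
      push_cast
      field_simp
      ring

/-! ### Averaging -/

lemma sum_mul_map_average_le {N : ℕ} {φ : Fin N → ℝ → ℝ}
    (hconv : ∀ i, ConvexOn ℝ Set.univ (φ i)) (A : Matrix (Fin N) (Fin d) ℝ)
    (s : Finset ℕ) (η : ℕ → ℝ) (hη : ∀ k, 0 < η k) (hs : s.Nonempty) (x : ℕ → Fin d → ℝ) :
    (∑ k ∈ s, η k) *
        ∑ i, φ i (dot (A i) fun t => (∑ k ∈ s, η k * x k t) / ∑ k ∈ s, η k)
      ≤ ∑ k ∈ s, η k * ∑ i, φ i (dot (A i) (x k)) := by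
  set H := ∑ k ∈ s, η k with hH
  have hH0 : 0 < H := Finset.sum_pos (fun k _ => hη k) hs
  simp only [Finset.mul_sum]
  rw [Finset.sum_comm (s := s)]
  refine Finset.sum_le_sum fun i _ => ?_
  have hJ := (hconv i).map_sum_le (t := s) (w := fun k => η k / H)
    (p := fun k => dot (A i) (x k)) (fun k _ => (div_pos (hη k) hH0).le)
    (by rw [← Finset.sum_div, div_self hH0.ne']) fun _ _ => Set.mem_univ _
  have e : dot (A i) (fun t => (∑ k ∈ s, η k * x k t) / H)
      = ∑ k ∈ s, (η k / H) • dot (A i) (x k) := by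
    simp only [dot, smul_eq_mul, Finset.mul_sum, Finset.sum_div]
    rw [Finset.sum_comm]
    exact Finset.sum_congr rfl fun _ _ => Finset.sum_congr rfl fun _ _ => by ring
  rw [e]
  calc H * _ ≤ H * ∑ k ∈ s, (η k / H) • φ i (dot (A i) (x k)) := by gcongr
    _ = _ := by
      rw [Finset.mul_sum]
      refine Finset.sum_congr rfl fun k _ => ?_
      rw [smul_eq_mul]
      field_simp

/-- **Theorem 3.2**: convergence bound for `K` epochs of incremental gradient descent
(shuffled SGD with a fixed data ordering). -/
theorem stmt5
    (b m d K : ℕ) (hb : 0 < b) (hm : 0 < m) (hK : 0 < K)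
    (A : Matrix (Fin (b * m)) (Fin d) ℝ)
    (ℓ ℓ' : Fin (b * m) → ℝ → ℝ) (L : Fin (b * m) → ℝ)
    (hL : ∀ i, 0 < L i)
    (hconv : ∀ i, ConvexOn ℝ Set.univ (ℓ i))
    (hderiv : ∀ i t, HasDerivAt (ℓ i) (ℓ' i t) t)
    (hsmooth : ∀ i s t, |ℓ' i s - ℓ' i t| ≤ L i * |s - t|)
    (xstar : Fin d → ℝ)
    (hmin : ∀ x : Fin d → ℝ,
      (1 / ((b * m : ℕ) : ℝ)) * ∑ i, ℓ i (dot (A i) xstar)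
        ≤ (1 / ((b * m : ℕ) : ℝ)) * ∑ i, ℓ i (dot (A i) x))
    (η : ℕ → ℝ) (hη : ∀ k, 0 < η k)
    (hstep : ∀ k < K,
      η k ≤ (b : ℝ) / (((b * m : ℕ) : ℝ) * Real.sqrt (2 * hatC A L 1 * tilC A L 1)))
    (x0 : Fin d → ℝ) :
    let n : ℝ := ((b * m : ℕ) : ℝ)
    let f : (Fin d → ℝ) → ℝ := fun x => (1 / n) * ∑ i, ℓ i (dot (A i) x)
    let ystar : Fin (b * m) → ℝ := fun i => ℓ' i (dot (A i) xstar)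
    let σ2 : ℝ := (1 / n) * ∑ i, (ystar i) ^ 2 * sq (A i)
    let Lh0 : ℝ := hatC A L 1
    let Lt0 : ℝ := tilC A L 1
    let HK : ℝ := ∑ k ∈ Finset.range K, η k
    let πs : ℕ → Equiv.Perm (Fin (b * m)) := fun _ => 1
    HK * (f (fun t => (∑ k ∈ Finset.range K, η k * xSeq A ℓ' η πs x0 (k + 1) t) / HK)
            - f xstar)
      ≤ ((b : ℝ) / (2 * n)) * sq (fun t => x0 t - xstar t)
        + ∑ k ∈ Finset.range K,
            min (((η k) ^ 3 * n / (b : ℝ) ^ 2) * Lh0 * Lt0 * wsq L ystar)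
              (((η k) ^ 3 * (n - (b : ℝ)) ^ 2 / (b : ℝ) ^ 2) * Lt0 * σ2) := by
  intro n f ystar σ2 Lh0 Lt0 HK πs
  have hb' : (0 : ℝ) < b := by positivity
  have hm' : (0 : ℝ) < m := by positivity
  have hn : 0 < n := by simp only [n]; push_cast; positivity
  have hnbm : n = b * m := by simp only [n]; push_cast; ring
  have hmin' : ∀ x : Fin d → ℝ, ∑ i, ℓ i (dot (A i) xstar) ≤ ∑ i, ℓ i (dot (A i) x) :=
    fun x => le_of_mul_le_mul_left (hmin x) (one_div_pos.2 hn)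
  have hgrad := sum_grad_eq_zero A hderiv xstar hmin'
  have hLt : 0 ≤ Lt0 := tilC_nonneg A L 1
  set Y := ∑ i : Fin m, sq (tailComb A ystar i.1)
  set D : ℕ → ℝ := fun k => sq fun t => xSeq A ℓ' η πs x0 k t - xstar t with hD
  set F : (Fin d → ℝ) → ℝ := fun x => ∑ i, ℓ i (dot (A i) x) with hF
  have hres : ∀ k, η k ^ 3 / b * Lt0 * Y / n
      ≤ min (((η k) ^ 3 * n / (b : ℝ) ^ 2) * Lh0 * Lt0 * wsq L ystar)
          (((η k) ^ 3 * (n - (b : ℝ)) ^ 2 / (b : ℝ) ^ 2) * Lt0 * σ2) := by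
    intro k
    have hk := hη k
    refine le_min ?_ ?_
    · calc η k ^ 3 / b * Lt0 * Y / n
          ≤ η k ^ 3 / b * Lt0 * (m * n * Lh0 * wsq L ystar) / n := by
            gcongr
            exact sum_sq_tailComb_le hb hm A hL ystar
        _ = _ := by rw [hnbm]; field_simp
    · calc η k ^ 3 / b * Lt0 * Y / n
          ≤ η k ^ 3 / b * Lt0 * ((n - b) ^ 2 / b * ∑ l, ystar l ^ 2 * sq (A l)) / n := by
            gcongr
            exact sum_sq_tailComb_le_of_sum_eq_zero hb A ystar hgrad hm
        _ = _ := by simp only [σ2]; field_simp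
  have hepoch : ∀ k ∈ Finset.range K, η k * (F (xSeq A ℓ' η πs x0 (k + 1)) - F xstar)
      ≤ b / 2 * (D k - D (k + 1)) + η k ^ 3 / b * Lt0 * Y := fun k hk =>
    epoch_descent hb hm A hL hconv hderiv hsmooth xstar (hη k)
      (hstep k (Finset.mem_range.1 hk)) (xSeq A ℓ' η πs x0 k)
  have havg := sum_mul_map_average_le hconv A (Finset.range K) η hη
    (Finset.nonempty_range_iff.2 hK.ne') fun k => xSeq A ℓ' η πs x0 (k + 1)
  have hsum := Finset.sum_le_sum hepoch
  rw [Finset.sum_add_distrib, ← Finset.mul_sum, Finset.sum_range_sub'] at hsum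
  simp only [mul_sub, Finset.sum_sub_distrib, ← Finset.sum_mul] at hsum
  have hDK : 0 ≤ D K := vec_sq_nonneg _
  have hD0 : D 0 = sq fun t => x0 t - xstar t := rfl
  set xhat : Fin d → ℝ :=
    fun t => (∑ k ∈ Finset.range K, η k * xSeq A ℓ' η πs x0 (k + 1) t) / HK
  have hmain : HK * (F xhat - F xstar)
      ≤ b / 2 * D 0 + ∑ k ∈ Finset.range K, η k ^ 3 / b * Lt0 * Y := by
    have h : HK * F xhat ≤ ∑ k ∈ Finset.range K, η k * F (xSeq A ℓ' η πs x0 (k + 1)) := havg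
    have hbD := mul_nonneg hb'.le hDK
    simp only [mul_sub, ← Finset.sum_mul]
    linarith
  calc HK * (f xhat - f xstar) = HK * (F xhat - F xstar) / n := by simp only [f, hF]; ring
    _ ≤ (b / 2 * D 0 + ∑ k ∈ Finset.range K, η k ^ 3 / b * Lt0 * Y) / n := by gcongr
    _ = b / (2 * n) * D 0 + ∑ k ∈ Finset.range K, η k ^ 3 / b * Lt0 * Y / n := by
      rw [add_div, Finset.sum_div]; congr 1; field_simp
    _ ≤ _ := by
      rw [hD0]
      gcongr with k
      exact hres k
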